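/- arXiv:math/0311537 — 2 statements merged into one kernel-verified Lean document; each statement's English description precedes it below -/
import Mathlib

section
/- Let C ⊂ P^n be an (n−k)-rope supported on a line, with left type (β_1,...,β_k). Then the Hilbert function of C is h_C(j) = C(j+1,1) + (r+1)·C(j,1) − ∑_{h=1}^k C(j−β_h,1), where r = n−2 and C(a,1) denotes the binomial coefficient which is a if a ≥ 1 and 0 if a < 1. -/
open MvPolynomial Matrix

namespace RopeHF

/-- Polynomials homogeneous of degree `m - 1` (zero when `m = 0`). -/
noncomputable def T (K : Type*) [Field K] : ℕ → Submodule K (MvPolynomial (Fin 2) K)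
  | 0 => ⊥
  | m + 1 => homogeneousSubmodule (Fin 2) K m

theorem finrank_hom (K : Type*) [Field K] (n : ℕ) :
    Module.finrank K (homogeneousSubmodule (Fin 2) K n) = n + 1 := by
  rw [homogeneousSubmodule_eq_finsupp_supported]
  rw [(AddMonoidAlgebra.supportedEquivFinsupp (R := K) (S := K)
    {d : Fin 2 →₀ ℕ | d.degree = n}).finrank_eq]
  let e : {d : Fin 2 →₀ ℕ | d.degree = n} ≃ Fin (n + 1) :=
    { toFun := fun d => ⟨d.1 0, by
        have := d.2
        simp [Finsupp.degree_eq_sum] at this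
        omega⟩
      invFun := fun a => ⟨Finsupp.equivFunOnFinite.symm ![a.1, n - a.1], by
        simp [Finsupp.degree_eq_sum]
        omega⟩
      left_inv := fun d => by
        have := d.2
        simp [Finsupp.degree_eq_sum] at this
        ext i
        fin_cases i
        · simp
        · simp
          omega
      right_inv := fun a => by
        ext
        simp }
  rw [(Finsupp.domLCongr (M := K) (R := K) e).finrank_eq]
  simp

theorem finite_hom (K : Type*) [Field K] (n : ℕ) :
    Module.Finite K (homogeneousSubmodule (Fin 2) K n) :=
  Module.finite_of_finrank_pos (by rw [finrank_hom]; omega)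

theorem finrank_T (K : Type*) [Field K] (n : ℕ) : Module.finrank K (T K n) = n := by
  cases n with
  | zero => exact finrank_bot K (MvPolynomial (Fin 2) K)
  | succ m => exact finrank_hom K m

theorem finite_T (K : Type*) [Field K] (n : ℕ) : Module.Finite K (T K n) := by
  cases n with
  | zero => exact inferInstanceAs (Module.Finite K (⊥ : Submodule K (MvPolynomial (Fin 2) K)))
  | succ m => exact finite_hom K m

theorem mul_mem_T {K : Type*} [Field K] {b n : ℕ} {f g : MvPolynomial (Fin 2) K}
    (hf : f.IsHomogeneous b) (hg : g ∈ T K n) : f * g ∈ T K (n + b) := by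
  cases n with
  | zero =>
    have : g = 0 := by simpa [T] using hg
    simp [this]
  | succ m =>
    have hg : g.IsHomogeneous m := hg
    rw [show m + 1 + b = (b + m) + 1 by omega]
    exact hf.mul hg

theorem comp_mul {K : Type*} [Field K] {b : ℕ} (n : ℕ) {f : MvPolynomial (Fin 2) K}
    (hf : f.IsHomogeneous b) (g : MvPolynomial (Fin 2) K) :
    homogeneousComponent n (f * g) =
      if b ≤ n then f * homogeneousComponent (n - b) g else 0 := by
  letI : GradedAlgebra (homogeneousSubmodule (Fin 2) K) := gradedAlgebra
  have := DirectSum.coe_decompose_mul_of_left_mem (homogeneousSubmodule (Fin 2) K) (b := g) n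
    ((mem_homogeneousSubmodule _ _).2 hf)
  have key : ∀ (p : MvPolynomial (Fin 2) K) (i : ℕ),
      (DirectSum.decompose (homogeneousSubmodule (Fin 2) K) p i : MvPolynomial (Fin 2) K)
        = homogeneousComponent i p := fun p i => decomposition.decompose'_apply p i
  rw [key, key] at this
  exact this

/-- homogeneous solution. -/
theorem exists_hom_sol {K : Type*} [Field K] {r k : ℕ} {β : Fin k → ℕ}
    {B : Matrix (Fin (r + 1)) (Fin k) (MvPolynomial (Fin 2) K)}
    (hB : ∀ i s, (B i s).IsHomogeneous (β s)) (j : ℕ)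
    (w : Fin k → MvPolynomial (Fin 2) K) (hw : ∀ i, (B *ᵥ w) i ∈ T K j) :
    ∃ w' : Fin k → MvPolynomial (Fin 2) K, (∀ s, w' s ∈ T K (j - β s)) ∧ B *ᵥ w' = B *ᵥ w := by
  cases j with
  | zero =>
    refine ⟨0, fun s => Submodule.zero_mem _, ?_⟩
    ext1 i
    have : (B *ᵥ w) i = 0 := by simpa [T] using hw i
    simp [this]
  | succ m =>
    refine ⟨fun s => if β s ≤ m then homogeneousComponent (m - β s) (w s) else 0, ?_, ?_⟩
    · intro s
      beta_reduce
      by_cases h : β s ≤ m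
      · rw [if_pos h, show m + 1 - β s = (m - β s) + 1 by omega]
        exact homogeneousComponent_mem _ _
      · rw [if_neg h]
        exact Submodule.zero_mem _
    · ext1 i
      have h1 : homogeneousComponent m ((B *ᵥ w) i) = (B *ᵥ w) i := by
        rw [homogeneousComponent_of_mem (hw i), if_pos rfl]
      rw [← h1]
      simp only [mulVec, dotProduct, map_sum]
      refine Finset.sum_congr rfl fun s _ => ?_
      rw [comp_mul m (hB i s)]
      split_ifs <;> simp

theorem B_inj {K : Type*} [Field K] {r k : ℕ}
    {B : Matrix (Fin (r + 1)) (Fin k) (MvPolynomial (Fin 2) K)}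
    (hcodimB : Ideal.span {(X 0 : MvPolynomial (Fin 2) K), X 1} ≤
      (Ideal.span {f | ∃ c : Fin k ↪ Fin (r + 1), f = (B.submatrix ⇑c id).det}).radical)
    (w : Fin k → MvPolynomial (Fin 2) K) (hw : B *ᵥ w = 0) : w = 0 := by
  have : ∃ c : Fin k ↪ Fin (r + 1), (B.submatrix ⇑c id).det ≠ 0 := by
    by_contra! h
    have h0 : Ideal.span {f | ∃ c : Fin k ↪ Fin (r + 1), f = (B.submatrix ⇑c id).det} = ⊥ := by
      rw [Ideal.span_eq_bot]
      rintro f ⟨c, rfl⟩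
      exact h c
    rw [h0] at hcodimB
    have h1 : (X 0 : MvPolynomial (Fin 2) K) ∈ (⊥ : Ideal (MvPolynomial (Fin 2) K)).radical :=
      hcodimB (Ideal.subset_span (by simp))
    obtain ⟨n, hn⟩ := h1
    exact X_ne_zero (R := K) (0 : Fin 2) (by
      by_contra hx
      exact pow_ne_zero n hx ((Submodule.mem_bot _).1 hn))
  obtain ⟨c, hc⟩ := this
  refine Matrix.eq_zero_of_mulVec_eq_zero hc ?_
  ext1 i
  exact congrFun hw (c i)

/-- the section. -/
noncomputable def σ (K : Type*) [Field K] (r : ℕ) :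
    (MvPolynomial (Fin 2) K × (Fin (r + 1) → MvPolynomial (Fin 2) K)) →ₗ[K]
      MvPolynomial (Fin (r + 1) ⊕ Fin 2) K where
  toFun p := rename Sum.inr p.1 + ∑ i, X (Sum.inl i) * rename Sum.inr (p.2 i)
  map_add' p q := by
    simp only [Prod.fst_add, Prod.snd_add, Pi.add_apply, map_add, mul_add, Finset.sum_add_distrib]
    ring
  map_smul' a p := by
    simp [Finset.smul_sum]

theorem σ_apply {K : Type*} [Field K] {r : ℕ}
    (p : MvPolynomial (Fin 2) K × (Fin (r + 1) → MvPolynomial (Fin 2) K)) :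
    σ K r p = rename Sum.inr p.1 + ∑ i, X (Sum.inl i) * rename Sum.inr (p.2 i) := rfl

theorem σ_hom {K : Type*} [Field K] {r j : ℕ}
    {s : MvPolynomial (Fin 2) K} {v : Fin (r + 1) → MvPolynomial (Fin 2) K}
    (hs : s.IsHomogeneous j) (hv : ∀ i, v i ∈ T K j) :
    (σ K r (s, v)).IsHomogeneous j := by
  rw [σ_apply]
  refine hs.rename_isHomogeneous.add (IsHomogeneous.sum _ _ _ fun i _ => ?_)
  cases j with
  | zero =>
    have : v i = 0 := by simpa [T] using hv i
    simp [this, isHomogeneous_zero]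
  | succ m =>
    have hi : (v i).IsHomogeneous m := hv i
    rw [add_comm m 1]
    exact (isHomogeneous_X K _).mul hi.rename_isHomogeneous

theorem approx_mono {K : Type*} [Field K] {r : ℕ}
    {IL : Ideal (MvPolynomial (Fin (r + 1) ⊕ Fin 2) K)}
    (hIL : IL = Ideal.span (Set.range fun i : Fin (r + 1) =>
      (X (Sum.inl i) : MvPolynomial (Fin (r + 1) ⊕ Fin 2) K)))
    (a : K) (d : (Fin (r + 1) ⊕ Fin 2) →₀ ℕ) :
    ∃ s v, s.IsHomogeneous d.degree ∧ (∀ i, v i ∈ T K d.degree) ∧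
      monomial d a - σ K r (s, v) ∈ IL ^ 2 := by
  have hX : ∀ i, (X (Sum.inl i) : MvPolynomial (Fin (r + 1) ⊕ Fin 2) K) ∈ IL := fun i => by
    rw [hIL]; exact Ideal.subset_span ⟨i, rfl⟩
  suffices H : ∀ n (d : (Fin (r + 1) ⊕ Fin 2) →₀ ℕ), d.degree = n →
      ∃ s v, s.IsHomogeneous n ∧ (∀ i, v i ∈ T K n) ∧
      monomial d a - σ K r (s, v) ∈ IL ^ 2 from H _ d rfl
  intro n
  induction n with
  | zero =>
    intro d hd
    have : d = 0 := (Finsupp.degree_eq_zero_iff d).1 hd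
    subst this
    refine ⟨C a, 0, isHomogeneous_C _ _, fun i => Submodule.zero_mem _, ?_⟩
    simp [σ_apply]
  | succ n ih =>
    intro d hd
    have hne : d ≠ 0 := by rintro rfl; simp at hd
    obtain ⟨x, hx⟩ := Finsupp.ne_iff.1 hne
    have hle : Finsupp.single x 1 ≤ d := by
      rw [Finsupp.single_le_iff]
      simpa [Nat.one_le_iff_ne_zero] using hx
    obtain ⟨e, rfl⟩ := exists_add_of_le hle
    have he : e.degree = n := by
      simp at hd; omega
    obtain ⟨s, v, hs, hv, hm⟩ := ih e he
    rw [monomial_single_add, pow_one]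
    rcases x with i | t
    · refine ⟨0, Pi.single i s, isHomogeneous_zero _ _ _, ?_, ?_⟩
      · intro l
        by_cases h : l = i
        · subst h; simpa [T] using hs
        · simp [Pi.single_eq_of_ne h]
      · have h1 : σ K r (0, Pi.single i s) = X (Sum.inl i) * rename Sum.inr s := by
          rw [σ_apply]
          simp only [map_zero, zero_add]
          rw [Finset.sum_eq_single i]
          · simp
          · intro l _ hl
            simp [Pi.single_eq_of_ne hl]
          · simp
        have h2 : X (Sum.inl i) * monomial e a - σ K r (0, Pi.single i s) =
            X (Sum.inl i) * (monomial e a - σ K r (s, v)) +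
              X (Sum.inl i) * ∑ i, X (Sum.inl i) * rename Sum.inr (v i) := by
          rw [h1, σ_apply]; ring
        rw [h2]
        refine add_mem (Ideal.mul_mem_left _ _ hm) ?_
        rw [pow_two]
        exact Ideal.mul_mem_mul (hX i) (sum_mem fun l _ => Ideal.mul_mem_right _ _ (hX l))
    · refine ⟨X t * s, fun i => X t * v i, ?_, ?_, ?_⟩
      · rw [add_comm n 1]; exact (isHomogeneous_X K t).mul hs
      · intro i; exact mul_mem_T (isHomogeneous_X K t) (hv i)
      · have h2 : X (Sum.inr t) * monomial e a - σ K r (X t * s, fun i => X t * v i) =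
            X (Sum.inr t) * (monomial e a - σ K r (s, v)) := by
          simp only [σ_apply, map_mul, rename_X, mul_sub, mul_add, Finset.mul_sum]
          congr 2
          exact Finset.sum_congr rfl fun i _ => by ring
        rw [h2]
        exact Ideal.mul_mem_left _ _ hm

theorem approx {K : Type*} [Field K] {r : ℕ}
    {IL : Ideal (MvPolynomial (Fin (r + 1) ⊕ Fin 2) K)}
    (hIL : IL = Ideal.span (Set.range fun i : Fin (r + 1) =>
      (X (Sum.inl i) : MvPolynomial (Fin (r + 1) ⊕ Fin 2) K)))
    {j : ℕ} (f : MvPolynomial (Fin (r + 1) ⊕ Fin 2) K) (hf : f.IsHomogeneous j) :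
    ∃ s v, s.IsHomogeneous j ∧ (∀ i, v i ∈ T K j) ∧ f - σ K r (s, v) ∈ IL ^ 2 := by
  choose s v hs hv hm using fun d => approx_mono hIL (coeff d f) d
  have hdeg : ∀ d ∈ f.support, d.degree = j := fun d hd => by
    have := hf (mem_support_iff.1 hd)
    rw [Finsupp.degree_eq_weight_one]
    exact this
  refine ⟨∑ d ∈ f.support, s d, ∑ d ∈ f.support, v d, ?_, ?_, ?_⟩
  · exact IsHomogeneous.sum _ _ _ fun d hd => hdeg d hd ▸ hs d
  · intro i
    rw [Finset.sum_apply]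
    exact sum_mem fun d hd => hdeg d hd ▸ hv d i
  · have : f - σ K r (∑ d ∈ f.support, s d, ∑ d ∈ f.support, v d) =
        ∑ d ∈ f.support, (monomial d (coeff d f) - σ K r (s d, v d)) := by
      rw [Finset.sum_sub_distrib, support_sum_monomial_coeff, ← map_sum]
      congr 2
      exact Prod.ext (by simp [Prod.fst_sum]) (by simp [Prod.snd_sum])
    rw [this]
    exact sum_mem fun d _ => hm d

/-- projection -/
noncomputable def φ (K : Type*) [Field K] (r : ℕ) :
    MvPolynomial (Fin (r + 1) ⊕ Fin 2) K →ₐ[K]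
      TrivSqZeroExt (MvPolynomial (Fin 2) K) (Fin (r + 1) → MvPolynomial (Fin 2) K) :=
  aeval (Sum.elim (fun i => TrivSqZeroExt.inr (Pi.single i 1)) (fun t => TrivSqZeroExt.inl (X t)))

theorem φ_rename {K : Type*} [Field K] {r : ℕ} (s : MvPolynomial (Fin 2) K) :
    φ K r (rename Sum.inr s) = TrivSqZeroExt.inl s := by
  have : (φ K r).comp (rename Sum.inr) = TrivSqZeroExt.inlAlgHom K (MvPolynomial (Fin 2) K)
      (Fin (r + 1) → MvPolynomial (Fin 2) K) := by
    ext1 t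
    simp [φ]
  exact DFunLike.congr_fun this s

theorem φ_lin {K : Type*} [Field K] {r : ℕ} (v : Fin (r + 1) → MvPolynomial (Fin 2) K) :
    φ K r (∑ i, X (Sum.inl i) * rename Sum.inr (v i)) = TrivSqZeroExt.inr v := by
  have h : ∀ i, φ K r (X (Sum.inl i) * rename Sum.inr (v i)) =
      TrivSqZeroExt.inr (Pi.single i (v i)) := by
    intro i
    rw [map_mul, φ_rename]
    simp only [φ, aeval_X, Sum.elim_inl]
    rw [TrivSqZeroExt.inr_mul_inl]
    congr 1
    ext1 l
    by_cases hl : l = i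
    · subst hl; simp
    · simp [Pi.single_eq_of_ne hl]
  rw [map_sum]
  simp_rw [h]
  rw [← TrivSqZeroExt.inr_sum, Finset.univ_sum_single]

/-- target ideal -/
def J {K : Type*} [Field K] {r k : ℕ} (B : Matrix (Fin (r + 1)) (Fin k) (MvPolynomial (Fin 2) K)) :
    Ideal (TrivSqZeroExt (MvPolynomial (Fin 2) K) (Fin (r + 1) → MvPolynomial (Fin 2) K)) where
  carrier := {x | x.fst = 0 ∧ ∃ w, B *ᵥ w = x.snd}
  zero_mem' := ⟨rfl, 0, by simp⟩
  add_mem' := by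
    rintro x y ⟨hx, w, hw⟩ ⟨hy, w', hw'⟩
    refine ⟨by simp [hx, hy], w + w', by simp [mulVec_add, hw, hw']⟩
  smul_mem' := by
    rintro a x ⟨hx, w, hw⟩
    refine ⟨by simp [hx], a.fst • w, by simp [mulVec_smul, hx, hw]⟩

theorem IC_le {K : Type*} [Field K] {r k : ℕ}
    (B : Matrix (Fin (r + 1)) (Fin k) (MvPolynomial (Fin 2) K))
    {IL IC : Ideal (MvPolynomial (Fin (r + 1) ⊕ Fin 2) K)}
    (hIL : IL = Ideal.span (Set.range fun i : Fin (r + 1) =>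
      (X (Sum.inl i) : MvPolynomial (Fin (r + 1) ⊕ Fin 2) K)))
    (hIC : IC = IL ^ 2 ⊔ Ideal.span (Set.range fun s : Fin k =>
      ∑ i, X (Sum.inl i) * rename Sum.inr (B i s))) :
    IC ≤ (J B).comap (φ K r) := by
  have h1 : ∀ x ∈ IL, (φ K r x).fst = 0 := by
    have : IL ≤ RingHom.ker ((TrivSqZeroExt.fstHom K (MvPolynomial (Fin 2) K)
        (Fin (r + 1) → MvPolynomial (Fin 2) K)).comp (φ K r)) := by
      rw [hIL, Ideal.span_le]
      rintro _ ⟨i, rfl⟩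
      simp [RingHom.mem_ker, φ]
    exact fun x hx => this hx
  rw [hIC]
  refine sup_le ?_ ?_
  · rw [pow_two, Ideal.mul_le]
    intro x hx y hy
    rw [Ideal.mem_comap, map_mul]
    have : φ K r x * φ K r y = 0 := by
      ext1
      · simp [h1 x hx]
      · simp [h1 x hx, h1 y hy]
    rw [this]
    exact zero_mem _
  · rw [Ideal.span_le]
    rintro _ ⟨s, rfl⟩
    show φ K r (∑ i, X (Sum.inl i) * rename Sum.inr (B i s)) ∈ J B
    rw [φ_lin (fun i => B i s)]
    refine ⟨rfl, Pi.single s 1, ?_⟩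
    ext1 i
    simp

theorem σ_mem_iff {K : Type*} [Field K] {r k : ℕ}
    (B : Matrix (Fin (r + 1)) (Fin k) (MvPolynomial (Fin 2) K))
    {IL IC : Ideal (MvPolynomial (Fin (r + 1) ⊕ Fin 2) K)}
    (hIL : IL = Ideal.span (Set.range fun i : Fin (r + 1) =>
      (X (Sum.inl i) : MvPolynomial (Fin (r + 1) ⊕ Fin 2) K)))
    (hIC : IC = IL ^ 2 ⊔ Ideal.span (Set.range fun s : Fin k =>
      ∑ i, X (Sum.inl i) * rename Sum.inr (B i s)))
    (s : MvPolynomial (Fin 2) K) (v : Fin (r + 1) → MvPolynomial (Fin 2) K) :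
    σ K r (s, v) ∈ IC ↔ s = 0 ∧ ∃ w, B *ᵥ w = v := by
  constructor
  · intro h
    have h2 : φ K r (σ K r (s, v)) ∈ J B := IC_le B hIL hIC h
    rw [σ_apply, map_add, φ_rename, φ_lin] at h2
    obtain ⟨h3, w, hw⟩ := h2
    exact ⟨by simpa using h3, w, by simpa using hw⟩
  · rintro ⟨rfl, w, rfl⟩
    have : σ K r (0, B *ᵥ w) =
        ∑ s, rename Sum.inr (w s) * ∑ i, X (Sum.inl i) * rename Sum.inr (B i s) := by
      rw [σ_apply]
      simp only [map_zero, zero_add, mulVec, dotProduct, map_sum, map_mul, Finset.mul_sum]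
      rw [Finset.sum_comm]
      exact Finset.sum_congr rfl fun _ _ => Finset.sum_congr rfl fun _ _ => by ring
    rw [this, hIC]
    exact sum_mem fun s _ => Ideal.mul_mem_left _ _
      (Ideal.mem_sup_right (Ideal.subset_span ⟨s, rfl⟩))

theorem finrank_eq {K V W Q : Type*} [Field K] [AddCommGroup V] [AddCommGroup W] [AddCommGroup Q]
    [Module K V] [Module K W] [Module K Q] [Module.Finite K V]
    (i : W →ₗ[K] V) (p : V →ₗ[K] Q) (hi : Function.Injective i) (hp : Function.Surjective p)
    (h : LinearMap.range i = LinearMap.ker p) :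
    Module.finrank K Q + Module.finrank K W = Module.finrank K V := by
  rw [← LinearMap.finrank_range_add_finrank_ker p, LinearMap.range_eq_top.2 hp, finrank_top, ← h,
    LinearMap.finrank_range_of_inj hi]

end RopeHF

open RopeHF

/-- Let `C ⊂ Pⁿ` be the `(n-k)`-rope supported on the line
`L = {x_0 = … = x_r = 0}` (`r = n-2`), with homogeneous ideal
`I_C = ((I_L)², [x_0,…,x_r]·B)` in `R = K[x_0,…,x_r,t,u]`, where `B` is an
`(r+1) × k` matrix over `S = K[t,u]` whose `j`-th column is homogeneous of degree `β_j ≥ 1`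
and whose ideal of maximal minors has codimension 2.  Then the Hilbert function of `C`,
`h_C(j) = dim_K [R/I_C]_j`, equals
`C(j+1,1) + (r+1)·C(j,1) - ∑_{h=1}^k C(j-β_h,1)`, with `C(a,1) = max a 0`. -/
theorem stmt3 {K : Type*} [Field K] (r k : ℕ) (hk1 : 1 ≤ k) (hkr : k ≤ r)
    (β : Fin k → ℕ) (hβpos : ∀ h, 1 ≤ β h)
    (B : Matrix (Fin (r + 1)) (Fin k) (MvPolynomial (Fin 2) K))
    (hB : ∀ i s, (B i s).IsHomogeneous (β s))
    -- `codim I_k(B) = 2`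
    (hcodimB : Ideal.span {(X 0 : MvPolynomial (Fin 2) K), X 1} ≤
      (Ideal.span {f | ∃ c : Fin k ↪ Fin (r + 1), f = (B.submatrix ⇑c id).det}).radical)
    (IL IC : Ideal (MvPolynomial (Fin (r + 1) ⊕ Fin 2) K))
    (hIL : IL = Ideal.span (Set.range fun i : Fin (r + 1) =>
      (X (Sum.inl i) : MvPolynomial (Fin (r + 1) ⊕ Fin 2) K)))
    (hIC : IC = IL ^ 2 ⊔ Ideal.span (Set.range fun s : Fin k =>
      ∑ i, X (Sum.inl i) * rename Sum.inr (B i s)))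
    -- the Hilbert function of `C`
    (hC : ℕ → ℕ)
    (hhC : ∀ j : ℕ, hC j = Module.finrank K
      (↥(MvPolynomial.homogeneousSubmodule (Fin (r + 1) ⊕ Fin 2) K j) ⧸
        Submodule.comap
          (MvPolynomial.homogeneousSubmodule (Fin (r + 1) ⊕ Fin 2) K j).subtype
          (IC.restrictScalars K))) :
    ∀ j : ℕ, (hC j : ℤ)
      = ((j : ℤ) + 1) + (r + 1) * (j : ℤ) - ∑ h, max ((j : ℤ) - β h) 0 := by
  intro j
  rw [hhC j]
  have hBT : ∀ (w : (s : Fin k) → T K (j - β s)) (i : Fin (r + 1)),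
      (B *ᵥ (fun s => (w s : MvPolynomial (Fin 2) K))) i ∈ T K j := by
    intro w i
    simp only [mulVec, dotProduct]
    refine Submodule.sum_mem (T K j) fun s _ => ?_
    by_cases h : β s ≤ j
    · have := mul_mem_T (hB i s) (w s).2
      rwa [Nat.sub_add_cancel h] at this
    · have h0 : (w s : MvPolynomial (Fin 2) K) = 0 := by
        have := (w s).2
        generalize (w s : MvPolynomial (Fin 2) K) = g at this ⊢
        rw [show j - β s = 0 by omega] at this
        simpa [T] using this
      simp [h0]
  let iota : ((s : Fin k) → T K (j - β s)) →ₗ[K]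
      (homogeneousSubmodule (Fin 2) K j × (Fin (r + 1) → T K j)) :=
    { toFun := fun w => (0, fun i => ⟨_, hBT w i⟩)
      map_add' := fun w w' => by
        refine Prod.ext (by simp) ?_
        ext1 i
        apply Subtype.ext
        simp [mulVec, dotProduct, mul_add, Finset.sum_add_distrib]
      map_smul' := fun a w => by
        refine Prod.ext (by simp) ?_
        ext1 i
        apply Subtype.ext
        simp [mulVec, dotProduct, Finset.smul_sum] }
  let emb : (homogeneousSubmodule (Fin 2) K j × (Fin (r + 1) → T K j)) →ₗ[K]
      homogeneousSubmodule (Fin (r + 1) ⊕ Fin 2) K j :=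
    { toFun := fun p => ⟨σ K r (p.1, fun i => p.2 i), σ_hom p.1.2 fun i => (p.2 i).2⟩
      map_add' := fun p q => Subtype.ext
        (map_add (σ K r) ((p.1 : MvPolynomial (Fin 2) K), fun i => (p.2 i : MvPolynomial (Fin 2) K))
          ((q.1 : MvPolynomial (Fin 2) K), fun i => (q.2 i : MvPolynomial (Fin 2) K)))
      map_smul' := fun a p => Subtype.ext
        (map_smul (σ K r) a
          ((p.1 : MvPolynomial (Fin 2) K), fun i => (p.2 i : MvPolynomial (Fin 2) K))) }
  let N := Submodule.comap
          (MvPolynomial.homogeneousSubmodule (Fin (r + 1) ⊕ Fin 2) K j).subtype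
          (IC.restrictScalars K)
  haveI := finite_hom K j
  haveI := finite_T K
  have hfin := finrank_eq iota (N.mkQ ∘ₗ emb) ?_ ?_ ?_
  · have h1 : Module.finrank K ((s : Fin k) → T K (j - β s)) = ∑ s, (j - β s) := by
      rw [Module.finrank_pi_fintype]
      simp [finrank_T]
    have h2 : Module.finrank K (homogeneousSubmodule (Fin 2) K j × (Fin (r + 1) → T K j)) =
        (j + 1) + (r + 1) * j := by
      rw [Module.finrank_prod, Module.finrank_pi_fintype, finrank_hom]
      simp [finrank_T]
    rw [h1, h2] at hfin
    have h3 : ∑ h, max ((j : ℤ) - β h) 0 = ((∑ s, (j - β s) : ℕ) : ℤ) := by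
      push_cast
      exact Finset.sum_congr rfl fun s _ => by omega
    rw [h3, eq_sub_iff_add_eq]
    exact_mod_cast hfin
  · rw [← LinearMap.ker_eq_bot, LinearMap.ker_eq_bot']
    intro w hw
    have h0 : B *ᵥ (fun s => (w s : MvPolynomial (Fin 2) K)) = 0 := by
      ext1 i
      exact congrArg Subtype.val (congrFun (congrArg Prod.snd hw) i)
    have := B_inj hcodimB _ h0
    ext1 s
    exact Subtype.ext (congrFun this s)
  · intro q
    obtain ⟨f, rfl⟩ := N.mkQ_surjective q
    obtain ⟨s, v, hs, hv, hm⟩ := approx hIL f.1 f.2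
    refine ⟨(⟨s, hs⟩, fun i => ⟨v i, hv i⟩), ?_⟩
    symm
    rw [LinearMap.comp_apply, Submodule.mkQ_apply, Submodule.mkQ_apply, Submodule.Quotient.eq]
    show f.1 - σ K r (s, v) ∈ IC
    rw [hIC]
    exact Ideal.mem_sup_left hm
  · have hker : ∀ p, p ∈ LinearMap.ker (N.mkQ ∘ₗ emb) ↔
        σ K r ((p.1 : MvPolynomial (Fin 2) K), fun i => (p.2 i : MvPolynomial (Fin 2) K)) ∈ IC := by
      intro p
      rw [LinearMap.mem_ker, LinearMap.comp_apply, Submodule.mkQ_apply,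
        Submodule.Quotient.mk_eq_zero]
      rfl
    ext p
    rw [hker, σ_mem_iff B hIL hIC]
    constructor
    · rintro ⟨w, rfl⟩
      exact ⟨rfl, _, rfl⟩
    · rintro ⟨h1, w, hw⟩
      obtain ⟨w', hw', he⟩ := exists_hom_sol hB j w (fun i => by rw [hw]; exact (p.2 i).2)
      refine ⟨fun s => ⟨w' s, hw' s⟩, Prod.ext (Subtype.ext h1.symm) ?_⟩
      ext1 i
      exact Subtype.ext (congrFun (he.trans hw) i)
end

section
/- Let S = K[t,u] and let A be an (r+1−k)×(r+1) matrix over S of maximal rank whose maximal minors generate a codimension 2 ideal, with rows A_0,...,A_{r−k}. Consider the homogeneous linear system ∑_{h=0}^{r−k} a_{hi} c_h^{lj} − ∑_{h=0}^{r−k} a_{hj} c_h^{li} = 0 for all 0 ≤ j < i ≤ r and each fixed l. Then the S-module of solutions (in the unknowns c_h^{lj}) is free of rank C(r+2−k, 2), generated by the vectors (…,0, A_h, 0,…) for 0 ≤ h ≤ r−k and (…,0, A_{h'}, 0,…,0, A_h, 0,…) for 0 ≤ h < h' ≤ r−k. -/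
open MvPolynomial Matrix

/-- The `S`-module of solutions `c = (c_h^{j})_{h,j}` of the homogeneous linear system
`∑_h a_{hi} c_h^{j} - ∑_h a_{hj} c_h^{i} = 0` (for all `i, j`). -/
noncomputable def koszulSol {K : Type*} [Field K] (r k : ℕ)
    (A : Matrix (Fin (r + 1 - k)) (Fin (r + 1)) (MvPolynomial (Fin 2) K)) :
    Submodule (MvPolynomial (Fin 2) K)
      (Fin (r + 1 - k) → Fin (r + 1) → MvPolynomial (Fin 2) K) where
  carrier := {c | ∀ i j : Fin (r + 1),
    ∑ h, A h i * c h j = ∑ h, A h j * c h i}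
  add_mem' := by
    intro a b ha hb i j
    simp only [Pi.add_apply, mul_add, Finset.sum_add_distrib, ha i j, hb i j]
  zero_mem' := by
    intro i j
    simp
  smul_mem' := by
    intro s c hc i j
    simp only [Pi.smul_apply, smul_eq_mul, mul_left_comm, ← Finset.mul_sum, hc i j]

section helpers

variable {R : Type*} [CommRing R] [IsDomain R] {m n : Type*} [Fintype m] [DecidableEq m]

lemma smulA {l l' : Type*} (a : R) (ha : a ≠ 0) (D : Matrix l l' R) (h : a • D = 0) : D = 0 := by
  ext i j
  have : a * D i j = 0 := by simpa using congrFun (congrFun h i) j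
  exact (mul_eq_zero.mp this).resolve_left ha

lemma cancelA (A : Matrix m n R) (c : m → n) (hc : (A.submatrix id c).det ≠ 0)
    {l : Type*} (D : Matrix l m R) (h : D * A = 0) : D = 0 := by
  have h1 : D * A.submatrix id c = 0 := by
    ext i j
    exact congrFun (congrFun h i) (c j)
  have h2 : (A.submatrix id c).det • D = 0 := by
    have := congrArg (fun M => M * (A.submatrix id c).adjugate) h1
    simpa [Matrix.mul_assoc, Matrix.mul_adjugate] using this
  exact smulA _ hc _ h2

lemma idealA (A C : Matrix m n R) (h : Aᵀ * C = Cᵀ * A) (f : R)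
    (hf : f ∈ Ideal.span {f | ∃ c : m ↪ n, f = (A.submatrix id ⇑c).det}) :
    ∃ B : Matrix m m R, f • C = B * A := by
  refine Submodule.span_induction (p := fun f _ => ∃ B : Matrix m m R, f • C = B * A)
    ?_ ?_ ?_ ?_ hf
  · rintro _ ⟨c, rfl⟩
    refine ⟨(A.submatrix id c)ᵀ.adjugate * (C.submatrix id c)ᵀ, ?_⟩
    have h1 : (A.submatrix id c)ᵀ * C = (C.submatrix id c)ᵀ * A := by
      ext i j
      exact congrFun (congrFun h (c i)) j
    rw [Matrix.mul_assoc, ← h1, ← Matrix.mul_assoc, Matrix.adjugate_mul, Matrix.det_transpose]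
    simp
  · exact ⟨0, by simp⟩
  · rintro x y _ _ ⟨B, hB⟩ ⟨B', hB'⟩
    exact ⟨B + B', by rw [add_smul, hB, hB', Matrix.add_mul]⟩
  · rintro a x _ ⟨B, hB⟩
    exact ⟨a • B, by rw [smul_assoc, hB, Matrix.smul_mul]⟩

lemma symA (A : Matrix m n R) (c : m → n) (hc : (A.submatrix id c).det ≠ 0)
    (B : Matrix m m R) (h : Aᵀ * (B * A) = (B * A)ᵀ * A) : Bᵀ = B := by
  have h1 : (Aᵀ * B - Aᵀ * Bᵀ) * A = 0 := by
    rw [Matrix.sub_mul, Matrix.mul_assoc, h, Matrix.transpose_mul, sub_self]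
  have h2 := cancelA A c hc _ h1
  have h3 : (Bᵀ - B) * A = 0 := by
    have := congrArg Matrix.transpose h2
    simpa [Matrix.transpose_sub, Matrix.transpose_mul, Matrix.sub_mul] using this
  exact sub_eq_zero.mp (cancelA A c hc _ h3)

end helpers

lemma exB {K : Type*} [Field K] {m n : Type*} [Fintype m] [DecidableEq m]
    (A C : Matrix m n (MvPolynomial (Fin 2) K)) (h : Aᵀ * C = Cᵀ * A)
    (c : m → n) (hc : (A.submatrix id c).det ≠ 0)
    (hcodimA : Ideal.span {(X 0 : MvPolynomial (Fin 2) K), X 1} ≤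
      (Ideal.span {f | ∃ c : m ↪ n, f = (A.submatrix id ⇑c).det}).radical) :
    ∃ B : Matrix m m (MvPolynomial (Fin 2) K), C = B * A := by
  obtain ⟨a, ha⟩ := hcodimA (Ideal.subset_span (by simp : (X 0 : MvPolynomial (Fin 2) K) ∈ _))
  obtain ⟨b, hb⟩ := hcodimA (Ideal.subset_span (by simp : (X 1 : MvPolynomial (Fin 2) K) ∈ _))
  obtain ⟨B1, h1⟩ := idealA A C h _ ha
  obtain ⟨B2, h2⟩ := idealA A C h _ hb
  have h3 : ((X 1 : MvPolynomial (Fin 2) K) ^ b • B1 - (X 0 : MvPolynomial (Fin 2) K) ^ a • B2) * A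
      = 0 := by
    rw [Matrix.sub_mul, Matrix.smul_mul, Matrix.smul_mul, ← h1, ← h2, smul_comm, sub_self]
  have h4 := sub_eq_zero.mp (cancelA A c hc _ h3)
  have hdvd : ∀ i j, (X 0 : MvPolynomial (Fin 2) K) ^ a ∣ B1 i j := by
    intro i j
    have h5 : (X 1 : MvPolynomial (Fin 2) K) ^ b * B1 i j = X 0 ^ a * B2 i j := by
      simpa using congrFun (congrFun h4 i) j
    have hp : Prime (X 0 : MvPolynomial (Fin 2) K) := MvPolynomial.X_prime
    refine hp.pow_dvd_of_dvd_mul_left a ?_ ⟨_, h5⟩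
    intro hd
    have := hp.dvd_of_dvd_pow hd
    rw [MvPolynomial.X_dvd_X] at this
    simp at this
  choose B hB using hdvd
  refine ⟨Matrix.of B, ?_⟩
  have h6 : (X 0 : MvPolynomial (Fin 2) K) ^ a • (C - Matrix.of B * A) = 0 := by
    have : B1 = (X 0 : MvPolynomial (Fin 2) K) ^ a • Matrix.of B := by
      ext1 i j
      simpa using hB i j
    rw [smul_sub, h1, this, Matrix.smul_mul, sub_self]
  exact sub_eq_zero.mp (smulA _ (pow_ne_zero _ (X_ne_zero 0)) _ h6)

/-- the sorted pair -/
def srt {m : Type*} [LinearOrder m] (a b : m) : {p : m × m // p.1 ≤ p.2} :=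
  ⟨(min a b, max a b), min_le_max⟩

lemma gen_entry {R : Type*} [CommRing R] {m n : Type*} [Fintype m] [LinearOrder m]
    (A : m → n → R) (p : {p : m × m // p.1 ≤ p.2}) (h : m) (j : n) :
    (if p.1.1 = p.1.2 then Pi.single p.1.1 (A p.1.1)
      else Pi.single p.1.1 (A p.1.2) + Pi.single p.1.2 (A p.1.1) : m → n → R) h j
    = ∑ b, if p = srt h b then A b j else 0 := by
  obtain ⟨⟨a, a'⟩, hp⟩ := p
  simp only at hp
  have key : ∀ b, ((⟨(a, a'), hp⟩ : {p : m × m // p.1 ≤ p.2}) = srt h b) ↔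
      (h = a ∧ b = a') ∨ (h = a' ∧ b = a) := by
    intro b
    simp only [srt, Subtype.mk.injEq, Prod.mk.injEq]
    rcases le_total h b with hb | hb
    · rw [min_eq_left hb, max_eq_right hb]
      constructor
      · rintro ⟨rfl, rfl⟩; simp
      · rintro (⟨rfl, rfl⟩ | ⟨rfl, rfl⟩)
        · simp
        · have := le_antisymm hp hb; simp [this]
    · rw [min_eq_right hb, max_eq_left hb]
      constructor
      · rintro ⟨rfl, rfl⟩; simp
      · rintro (⟨rfl, rfl⟩ | ⟨rfl, rfl⟩)
        · have := le_antisymm hp hb; simp [this]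
        · simp
  simp only [key]
  by_cases hE : a = a'
  · subst hE
    by_cases hh : h = a
    · subst hh; simp
    · simp [hh]
  · by_cases h1 : h = a
    · subst h1; simp [hE]
    · by_cases h2 : h = a'
      · subst h2; simp [hE, h1]
      · simp [hE, h1, h2]

lemma gen_sum {R : Type*} [CommRing R] {m n : Type*} [Fintype m] [LinearOrder m]
    (A : Matrix m n R) (gen : {p : m × m // p.1 ≤ p.2} → m → n → R)
    (hgen : ∀ p, gen p = if p.1.1 = p.1.2 then Pi.single p.1.1 (A p.1.1)
      else Pi.single p.1.1 (A p.1.2) + Pi.single p.1.2 (A p.1.1))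
    (g : {p : m × m // p.1 ≤ p.2} → R) :
    ∑ p, g p • gen p = (Matrix.of fun a b => g (srt a b)) * A := by
  ext h j
  simp only [Finset.sum_apply, Pi.smul_apply, smul_eq_mul, Matrix.mul_apply, Matrix.of_apply]
  have h1 : ∀ p, gen p h j = ∑ b, if p = srt h b then A b j else 0 := by
    intro p
    rw [hgen]
    exact gen_entry A p h j
  simp only [h1, Finset.mul_sum]
  rw [Finset.sum_comm]
  simp

/-- Let `A` be an `(r+1-k) × (r+1)` matrix over `S = K[t,u]` of maximal
rank whose maximal minors generate an ideal of codimension 2 (radical containing `(t,u)`),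
with rows `A_0,…,A_{r-k}` homogeneous of degrees `α_h`.  Then the `S`-module of solutions of
the homogeneous system `∑_h a_{hi} c_h^{j} - ∑_h a_{hj} c_h^{i} = 0` is free of rank
`C(r+2-k, 2)`: the vectors with `A_h` in slot `h` (for `h = h'`), resp. `A_{h'}` in slot `h`
and `A_h` in slot `h'` (for `h < h'`), form a basis. -/
theorem stmt18 {K : Type*} [Field K] (r k : ℕ) (hk1 : 1 ≤ k) (hkr : k ≤ r)
    (α : Fin (r + 1 - k) → ℕ) (hαpos : ∀ h, 1 ≤ α h)
    (A : Matrix (Fin (r + 1 - k)) (Fin (r + 1)) (MvPolynomial (Fin 2) K))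
    (hA : ∀ h j, (A h j).IsHomogeneous (α h))
    (hcodimA : Ideal.span {(X 0 : MvPolynomial (Fin 2) K), X 1} ≤
      (Ideal.span {f | ∃ c : Fin (r + 1 - k) ↪ Fin (r + 1),
        f = (A.submatrix id ⇑c).det}).radical)
    (gen : {p : Fin (r + 1 - k) × Fin (r + 1 - k) // p.1 ≤ p.2} →
      Fin (r + 1 - k) → Fin (r + 1) → MvPolynomial (Fin 2) K)
    (hgen : ∀ p, gen p = if p.1.1 = p.1.2 then Pi.single p.1.1 (A p.1.1)
      else Pi.single p.1.1 (A p.1.2) + Pi.single p.1.2 (A p.1.1)) :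
    (∀ p, gen p ∈ koszulSol r k A)
    ∧ LinearIndependent (MvPolynomial (Fin 2) K) gen
    ∧ Submodule.span (MvPolynomial (Fin 2) K) (Set.range gen) = koszulSol r k A
    ∧ Nat.card {p : Fin (r + 1 - k) × Fin (r + 1 - k) // p.1 ≤ p.2}
        = (r + 2 - k).choose 2 := by
  classical
  have hsol : ∀ C : Matrix (Fin (r + 1 - k)) (Fin (r + 1)) (MvPolynomial (Fin 2) K),
      C ∈ koszulSol r k A ↔ Aᵀ * C = Cᵀ * A := by
    intro C
    rw [← Matrix.ext_iff]
    simp only [Matrix.mul_apply, Matrix.transpose_apply]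
    refine forall_congr' fun i => forall_congr' fun j => ?_
    simp only [mul_comm (C _ i)]
  obtain ⟨c, hc⟩ : ∃ c : Fin (r + 1 - k) ↪ Fin (r + 1), (A.submatrix id c).det ≠ 0 := by
    by_contra! hcon
    have h0 : Ideal.span {f | ∃ c : Fin (r + 1 - k) ↪ Fin (r + 1),
        f = (A.submatrix id ⇑c).det} = ⊥ := by
      rw [Ideal.span_eq_bot]
      rintro _ ⟨c, rfl⟩
      exact hcon c
    rw [h0] at hcodimA
    obtain ⟨a, ha⟩ := hcodimA (Ideal.subset_span (by simp : (X 0 : MvPolynomial (Fin 2) K) ∈ _))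
    simp at ha
  have hsrt : ∀ p : {p : Fin (r + 1 - k) × Fin (r + 1 - k) // p.1 ≤ p.2},
      srt p.1.1 p.1.2 = p := by
    rintro ⟨⟨a, b⟩, h⟩
    simp only at h
    simp [srt, h]
  have hmem : ∀ g : {p : Fin (r + 1 - k) × Fin (r + 1 - k) // p.1 ≤ p.2} →
      MvPolynomial (Fin 2) K, ∑ p, g p • gen p ∈ koszulSol r k A := by
    intro g
    rw [gen_sum A gen hgen]
    refine (hsol _).2 ?_
    rw [Matrix.transpose_mul, Matrix.mul_assoc]
    congr 2
    ext1 a b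
    simp [srt, min_comm, max_comm]
  have hmem' : ∀ p, gen p ∈ koszulSol r k A := by
    intro p
    have := hmem (Pi.single p 1)
    simpa [Pi.single_apply, ite_smul] using this
  refine ⟨hmem', ?_, ?_, ?_⟩
  · rw [Fintype.linearIndependent_iff]
    intro g hg p
    rw [gen_sum A gen hgen] at hg
    have := congrFun (congrFun (cancelA A c hc _ hg) p.1.1) p.1.2
    simpa [hsrt] using this
  · apply le_antisymm
    · rw [Submodule.span_le]
      rintro _ ⟨p, rfl⟩
      exact hmem' p
    · intro C hC
      have hC' := (hsol C).1 hC
      obtain ⟨B, hB⟩ := exB A C hC' c hc hcodimA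
      have hs : Bᵀ = B := by
        apply symA A c hc
        rw [← hB]
        exact hC'
      have : C = ∑ p, B p.1.1 p.1.2 • gen p := by
        rw [gen_sum A gen hgen (fun p => B p.1.1 p.1.2), hB]
        congr 1
        ext1 a b
        simp only [srt, Matrix.of_apply]
        rcases le_total a b with h | h
        · simp [h]
        · simp only [h, min_eq_right, max_eq_left]
          exact congrFun (congrFun hs b) a |>.symm ▸ rfl
      rw [this]
      exact Submodule.sum_mem _ fun p _ =>
        Submodule.smul_mem _ _ (Submodule.subset_span ⟨p, rfl⟩)
  · rw [← Nat.card_congr (Sym2.sortEquiv (α := Fin (r + 1 - k))), Nat.card_eq_fintype_card,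
      Sym2.card, Fintype.card_fin]
    congr 1
    omega
end
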